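/- arXiv:2310.20528 — 8 statements merged into one kernel-verified Lean document; each statement's English description precedes it below -/
import Mathlib

section
/- Let β ∈ ℝ and let (u, w) be a smooth solution of the Mikhalev system. Define U(x,y,t) = u(x + β²y − βt, y, t − 2βy) and W(x,y,t) = w(x + β²y − βt, y, t − 2βy) − β·u(x + β²y − βt, y, t − 2βy). Then (U, W) is again a solution of the Mikhalev system. -/
/-- Partial derivative with respect to the first variable `x`. -/
noncomputable def pdx (u : ℝ → ℝ → ℝ → ℝ) (x y t : ℝ) : ℝ := deriv (fun s => u s y t) x

/-- Partial derivative with respect to the second variable `y`. -/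
noncomputable def pdy (u : ℝ → ℝ → ℝ → ℝ) (x y t : ℝ) : ℝ := deriv (fun s => u x s t) y

/-- Partial derivative with respect to the third variable `t`. -/
noncomputable def pdt (u : ℝ → ℝ → ℝ → ℝ) (x y t : ℝ) : ℝ := deriv (fun s => u x y s) t

/-- Smoothness of a function of three real variables. -/
def Smooth3 (u : ℝ → ℝ → ℝ → ℝ) : Prop :=
  ContDiff ℝ (⊤ : ℕ∞) (fun p : ℝ × ℝ × ℝ => u p.1 p.2.1 p.2.2)

/-- The Mikhalev system: `u_t = w_x` and `u_y = w_t - u w_x + w u_x`. -/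
def Mikhalev (u w : ℝ → ℝ → ℝ → ℝ) : Prop :=
  ∀ x y t : ℝ,
    pdt u x y t = pdx w x y t ∧
    pdy u x y t = pdt w x y t - u x y t * pdx w x y t + w x y t * pdx u x y t

theorem Smooth3.hasDerivAt_comp {u : ℝ → ℝ → ℝ → ℝ} (hu : Smooth3 u) {a b c : ℝ → ℝ}
    {a' b' c' s : ℝ} (ha : HasDerivAt a a' s) (hb : HasDerivAt b b' s) (hc : HasDerivAt c c' s) :
    HasDerivAt (fun r => u (a r) (b r) (c r))
      (a' * pdx u (a s) (b s) (c s) + b' * pdy u (a s) (b s) (c s)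
        + c' * pdt u (a s) (b s) (c s)) s := by
  have hd := (hu.differentiable (by simp) (a s, b s, c s)).hasFDerivAt
  set L := fderiv ℝ (fun p : ℝ × ℝ × ℝ => u p.1 p.2.1 p.2.2) (a s, b s, c s)
  have hx : pdx u (a s) (b s) (c s) = L (1, 0, 0) :=
    (hd.comp_hasDerivAt_of_eq (a s) ((hasDerivAt_id (a s)).prodMk
      ((hasDerivAt_const (a s) (b s)).prodMk (hasDerivAt_const (a s) (c s)))) rfl).deriv
  have hy : pdy u (a s) (b s) (c s) = L (0, 1, 0) :=
    (hd.comp_hasDerivAt_of_eq (b s) ((hasDerivAt_const (b s) (a s)).prodMk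
      ((hasDerivAt_id (b s)).prodMk (hasDerivAt_const (b s) (c s)))) rfl).deriv
  have ht : pdt u (a s) (b s) (c s) = L (0, 0, 1) :=
    (hd.comp_hasDerivAt_of_eq (c s) ((hasDerivAt_const (c s) (a s)).prodMk
      ((hasDerivAt_const (c s) (b s)).prodMk (hasDerivAt_id (c s)))) rfl).deriv
  have key : L (a', b', c') = a' * L (1, 0, 0) + b' * L (0, 1, 0) + c' * L (0, 0, 1) := by
    simp only [← smul_eq_mul, ← map_smul, ← map_add]
    simp
  rw [hx, hy, ht, ← key]
  exact hd.comp_hasDerivAt_of_eq s (ha.prodMk (hb.prodMk hc)) rfl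

theorem stmt_2 (β : ℝ) (u w : ℝ → ℝ → ℝ → ℝ)
    (hu : Smooth3 u) (hw : Smooth3 w) (h : Mikhalev u w) :
    Mikhalev (fun x y t => u (x + β ^ 2 * y - β * t) y (t - 2 * β * y))
      (fun x y t => w (x + β ^ 2 * y - β * t) y (t - 2 * β * y)
        - β * u (x + β ^ 2 * y - β * t) y (t - 2 * β * y)) := by
  intro x y t
  obtain ⟨h₁, h₂⟩ := h (x + β ^ 2 * y - β * t) y (t - 2 * β * y)
  have ax : HasDerivAt (fun s => s + β ^ 2 * y - β * t) 1 x :=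
    ((hasDerivAt_id x).add_const _).sub_const _
  have bx : HasDerivAt (fun _ : ℝ => y) 0 x := hasDerivAt_const x y
  have cx : HasDerivAt (fun _ : ℝ => t - 2 * β * y) 0 x := hasDerivAt_const x _
  have ay : HasDerivAt (fun s => x + β ^ 2 * s - β * t) (β ^ 2) y := by
    simpa using (((hasDerivAt_id y).const_mul (β ^ 2)).const_add x).sub_const (β * t)
  have cy : HasDerivAt (fun s => t - 2 * β * s) (-(2 * β)) y := by
    simpa using ((hasDerivAt_id y).const_mul (2 * β)).const_sub t
  have at' : HasDerivAt (fun s => x + β ^ 2 * y - β * s) (-β) t := by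
    simpa using ((hasDerivAt_id t).const_mul β).const_sub (x + β ^ 2 * y)
  have bt : HasDerivAt (fun _ : ℝ => y) 0 t := hasDerivAt_const t y
  have ct : HasDerivAt (fun s => s - 2 * β * y) 1 t := (hasDerivAt_id t).sub_const _
  have ux := hu.hasDerivAt_comp ax bx cx
  have uy := hu.hasDerivAt_comp ay (hasDerivAt_id y) cy
  have ut := hu.hasDerivAt_comp at' bt ct
  have wx := (hw.hasDerivAt_comp ax bx cx).sub (ux.const_mul β)
  have wt := (hw.hasDerivAt_comp at' bt ct).sub (ut.const_mul β)
  have eux := ux.deriv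
  have euy := uy.deriv
  have eut := ut.deriv
  have ewx := wx.deriv
  have ewt := wt.deriv
  constructor
  · refine eut.trans (Eq.trans ?_ ewx.symm)
    linear_combination h₁
  · refine euy.trans (Eq.trans ?_ (congrArg₂ (· + ·) (congrArg₂ (· - ·) ewt.symm
      (congrArg (_ * ·) ewx.symm)) (congrArg (_ * ·) eux.symm)))
    simp only [id]
    linear_combination h₂ - β * h₁
end

section
/- Let ε ∈ ℝ and let u : ℝ³ → ℝ be a smooth function of (x,y,t) satisfying the first two flows of the Burgers hierarchy, u_t = 2u·u_x + ε·u_xx and u_y = 3u²·u_x + 3ε·(u_x² + u·u_xx) + ε²·u_xxx, at every point. Then the pair (u, w) with w = u² + ε·u_x is a solution of the Mikhalev system. -/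
namespace Smooth3

variable {u : ℝ → ℝ → ℝ → ℝ}

theorem hasDerivAt_comp_line (hu : Smooth3 u) {γ : ℝ → ℝ × ℝ × ℝ} {v : ℝ × ℝ × ℝ} {s : ℝ}
    (hγ : HasDerivAt γ v s) :
    HasDerivAt (fun s => u (γ s).1 (γ s).2.1 (γ s).2.2)
      (fderiv ℝ (fun p : ℝ × ℝ × ℝ => u p.1 p.2.1 p.2.2) (γ s) v) s :=
  ((hu.differentiable (by simp)) (γ s)).hasFDerivAt.comp_hasDerivAt s hγ

theorem hasDerivAt_fst (hu : Smooth3 u) (x y t : ℝ) :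
    HasDerivAt (fun s => u s y t)
      (fderiv ℝ (fun p : ℝ × ℝ × ℝ => u p.1 p.2.1 p.2.2) (x, y, t) (1, 0, 0)) x :=
  hu.hasDerivAt_comp_line
    ((hasDerivAt_id x).prodMk ((hasDerivAt_const x y).prodMk (hasDerivAt_const x t)))

theorem hasDerivAt_trd (hu : Smooth3 u) (x y t : ℝ) :
    HasDerivAt (fun s => u x y s)
      (fderiv ℝ (fun p : ℝ × ℝ × ℝ => u p.1 p.2.1 p.2.2) (x, y, t) (0, 0, 1)) t :=
  hu.hasDerivAt_comp_line
    ((hasDerivAt_const t x).prodMk ((hasDerivAt_const t y).prodMk (hasDerivAt_id t)))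

theorem pdx_eq_fderiv (hu : Smooth3 u) (x y t : ℝ) :
    pdx u x y t =
      fderiv ℝ (fun p : ℝ × ℝ × ℝ => u p.1 p.2.1 p.2.2) (x, y, t) (1, 0, 0) :=
  (hu.hasDerivAt_fst x y t).deriv

theorem pdt_eq_fderiv (hu : Smooth3 u) (x y t : ℝ) :
    pdt u x y t =
      fderiv ℝ (fun p : ℝ × ℝ × ℝ => u p.1 p.2.1 p.2.2) (x, y, t) (0, 0, 1) :=
  (hu.hasDerivAt_trd x y t).deriv

theorem hasDerivAt_pdx (hu : Smooth3 u) (x y t : ℝ) :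
    HasDerivAt (fun s => u s y t) (pdx u x y t) x :=
  (hu.hasDerivAt_fst x y t).differentiableAt.hasDerivAt

theorem hasDerivAt_pdt (hu : Smooth3 u) (x y t : ℝ) :
    HasDerivAt (fun s => u x y s) (pdt u x y t) t :=
  (hu.hasDerivAt_trd x y t).differentiableAt.hasDerivAt

theorem contDiff_fderiv (hu : Smooth3 u) :
    ContDiff ℝ (⊤ : ℕ∞) (fderiv ℝ (fun p : ℝ × ℝ × ℝ => u p.1 p.2.1 p.2.2)) :=
  ContDiff.fderiv_right hu (by simp)

theorem smooth3_pdx (hu : Smooth3 u) : Smooth3 (pdx u) := by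
  simpa only [Smooth3, hu.pdx_eq_fderiv] using
    hu.contDiff_fderiv.clm_apply (contDiff_const (c := ((1, 0, 0) : ℝ × ℝ × ℝ)))

theorem smooth3_pdt (hu : Smooth3 u) : Smooth3 (pdt u) := by
  simpa only [Smooth3, hu.pdt_eq_fderiv] using
    hu.contDiff_fderiv.clm_apply (contDiff_const (c := ((0, 0, 1) : ℝ × ℝ × ℝ)))

/-- Symmetry of the mixed second derivative in `x` and `t`. -/
theorem pdt_pdx_comm (hu : Smooth3 u) (x y t : ℝ) :
    pdt (pdx u) x y t = pdx (pdt u) x y t := by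
  have hd : DifferentiableAt ℝ (fderiv ℝ (fun p : ℝ × ℝ × ℝ => u p.1 p.2.1 p.2.2)) (x, y, t) :=
    hu.contDiff_fderiv.differentiable (by simp) _
  have hsymm : IsSymmSndFDerivAt ℝ (fun p : ℝ × ℝ × ℝ => u p.1 p.2.1 p.2.2) (x, y, t) :=
    (ContDiff.contDiffAt hu).isSymmSndFDerivAt
      (by simpa using WithTop.coe_le_coe.mpr (le_top (a := (2 : ℕ∞))))
  rw [hu.smooth3_pdx.pdt_eq_fderiv, hu.smooth3_pdt.pdx_eq_fderiv]
  simp only [hu.pdx_eq_fderiv, hu.pdt_eq_fderiv, Prod.mk.eta]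
  rw [fderiv_clm_apply hd (differentiableAt_const _),
    fderiv_clm_apply hd (differentiableAt_const _)]
  simpa using hsymm (0, 0, 1) (1, 0, 0)

end Smooth3

theorem stmt_3 (ε : ℝ) (u : ℝ → ℝ → ℝ → ℝ) (hu : Smooth3 u)
    (ht : ∀ x y t : ℝ, pdt u x y t =
      2 * u x y t * pdx u x y t + ε * pdx (pdx u) x y t)
    (hy : ∀ x y t : ℝ, pdy u x y t =
      3 * (u x y t) ^ 2 * pdx u x y t
        + 3 * ε * ((pdx u x y t) ^ 2 + u x y t * pdx (pdx u) x y t)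
        + ε ^ 2 * pdx (pdx (pdx u)) x y t) :
    Mikhalev u (fun x y t => (u x y t) ^ 2 + ε * pdx u x y t) := by
  intro x y t
  have hwx : pdx (fun x y t => (u x y t) ^ 2 + ε * pdx u x y t) x y t =
      2 * u x y t * pdx u x y t + ε * pdx (pdx u) x y t := by
    refine (((hu.hasDerivAt_pdx x y t).pow 2).add
      ((hu.smooth3_pdx.hasDerivAt_pdx x y t).const_mul ε)).deriv.trans ?_
    simp
  have hwt : pdt (fun x y t => (u x y t) ^ 2 + ε * pdx u x y t) x y t =
      2 * u x y t * pdt u x y t + ε * pdt (pdx u) x y t := by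
    refine (((hu.hasDerivAt_pdt x y t).pow 2).add
      ((hu.smooth3_pdx.hasDerivAt_pdt x y t).const_mul ε)).deriv.trans ?_
    simp
  have huxt : pdx (pdt u) x y t =
      2 * pdx u x y t * pdx u x y t + 2 * u x y t * pdx (pdx u) x y t
        + ε * pdx (pdx (pdx u)) x y t := by
    have h := ((((hu.hasDerivAt_pdx x y t).const_mul 2).mul
      (hu.smooth3_pdx.hasDerivAt_pdx x y t)).add
      ((hu.smooth3_pdx.smooth3_pdx.hasDerivAt_pdx x y t).const_mul ε)).deriv
    rw [← h]
    exact congrArg (fun f => deriv f x) (funext fun s => ht s y t)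
  refine ⟨by rw [hwx, ht], ?_⟩
  rw [hwx, hwt, hu.pdt_pdx_comm, huxt, hy, ht]
  ring
end

section
/- Let ε ∈ ℝ and let u : ℝ³ → ℝ be a smooth function of (x,y,t) satisfying the first two flows of the KdV hierarchy, u_t = 3u·u_x + ε²·u_xxx and u_y = (15/2)·u²·u_x + 5ε²·(u·u_xxx + 2u_x·u_xx) + ε⁴·u_xxxxx, at every point. Then the pair (u, w) with w = (3/2)·u² + ε²·u_xx is a solution of the Mikhalev system. -/
/-- The function on the product space underlying a curried function of three variables. -/
def uncurried (u : ℝ → ℝ → ℝ → ℝ) (p : ℝ × ℝ × ℝ) : ℝ := u p.1 p.2.1 p.2.2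

theorem Smooth3.contDiff {u : ℝ → ℝ → ℝ → ℝ} (hu : Smooth3 u) :
    ContDiff ℝ (⊤ : ℕ∞) (uncurried u) := hu

theorem Smooth3.hasFDerivAt {u : ℝ → ℝ → ℝ → ℝ} (hu : Smooth3 u) (p : ℝ × ℝ × ℝ) :
    HasFDerivAt (uncurried u) (fderiv ℝ (uncurried u) p) p :=
  (hu.contDiff.differentiable (by simp) p).hasFDerivAt

theorem Smooth3.hasDerivAt_x_fderiv {u : ℝ → ℝ → ℝ → ℝ} (hu : Smooth3 u) (x y t : ℝ) :
    HasDerivAt (fun s => u s y t) (fderiv ℝ (uncurried u) (x, y, t) (1, 0, 0)) x :=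
  (hu.hasFDerivAt (x, y, t)).comp_hasDerivAt (f := fun s => (s, y, t)) x
    ((hasDerivAt_id x).prodMk ((hasDerivAt_const x y).prodMk (hasDerivAt_const x t)))

theorem Smooth3.hasDerivAt_t_fderiv {u : ℝ → ℝ → ℝ → ℝ} (hu : Smooth3 u) (x y t : ℝ) :
    HasDerivAt (fun s => u x y s) (fderiv ℝ (uncurried u) (x, y, t) (0, 0, 1)) t :=
  (hu.hasFDerivAt (x, y, t)).comp_hasDerivAt (f := fun s => (x, y, s)) t
    ((hasDerivAt_const t x).prodMk ((hasDerivAt_const t y).prodMk (hasDerivAt_id t)))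

theorem Smooth3.hasDerivAt_x {u : ℝ → ℝ → ℝ → ℝ} (hu : Smooth3 u) (x y t : ℝ) :
    HasDerivAt (fun s => u s y t) (pdx u x y t) x :=
  (hu.hasDerivAt_x_fderiv x y t).differentiableAt.hasDerivAt

theorem Smooth3.hasDerivAt_t {u : ℝ → ℝ → ℝ → ℝ} (hu : Smooth3 u) (x y t : ℝ) :
    HasDerivAt (fun s => u x y s) (pdt u x y t) t :=
  (hu.hasDerivAt_t_fderiv x y t).differentiableAt.hasDerivAt

theorem Smooth3.uncurried_pdx {u : ℝ → ℝ → ℝ → ℝ} (hu : Smooth3 u) :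
    uncurried (pdx u) = fun p => fderiv ℝ (uncurried u) p (1, 0, 0) :=
  funext fun p => (hu.hasDerivAt_x_fderiv p.1 p.2.1 p.2.2).deriv

theorem Smooth3.uncurried_pdt {u : ℝ → ℝ → ℝ → ℝ} (hu : Smooth3 u) :
    uncurried (pdt u) = fun p => fderiv ℝ (uncurried u) p (0, 0, 1) :=
  funext fun p => (hu.hasDerivAt_t_fderiv p.1 p.2.1 p.2.2).deriv

theorem Smooth3.contDiff_fderiv_s4 {u : ℝ → ℝ → ℝ → ℝ} (hu : Smooth3 u) :
    ContDiff ℝ (⊤ : ℕ∞) (fderiv ℝ (uncurried u)) :=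
  hu.contDiff.fderiv_right (by simp)

theorem Smooth3.pdx {u : ℝ → ℝ → ℝ → ℝ} (hu : Smooth3 u) : Smooth3 (pdx u) := by
  change ContDiff ℝ (⊤ : ℕ∞) (uncurried (_root_.pdx u))
  rw [hu.uncurried_pdx]
  exact hu.contDiff_fderiv_s4.clm_apply contDiff_const

theorem Smooth3.pdt {u : ℝ → ℝ → ℝ → ℝ} (hu : Smooth3 u) : Smooth3 (pdt u) := by
  change ContDiff ℝ (⊤ : ℕ∞) (uncurried (_root_.pdt u))
  rw [hu.uncurried_pdt]
  exact hu.contDiff_fderiv_s4.clm_apply contDiff_const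

theorem Smooth3.pdt_pdx {u : ℝ → ℝ → ℝ → ℝ} (hu : Smooth3 u) :
    _root_.pdt (_root_.pdx u) = _root_.pdx (_root_.pdt u) := by
  funext x y t
  have hd := (hu.contDiff_fderiv_s4.differentiable (by simp) (x, y, t)).hasFDerivAt
  have hx := (hu.pdx.hasDerivAt_t_fderiv x y t).deriv
  have ht := (hu.pdt.hasDerivAt_x_fderiv x y t).deriv
  rw [hu.uncurried_pdx, (hd.clm_apply (hasFDerivAt_const _ _)).fderiv] at hx
  rw [hu.uncurried_pdt, (hd.clm_apply (hasFDerivAt_const _ _)).fderiv] at ht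
  have hsymm : IsSymmSndFDerivAt ℝ (uncurried u) (x, y, t) :=
    hu.contDiff.contDiffAt.isSymmSndFDerivAt
      (by rw [minSmoothness_of_isRCLikeNormedField]; exact WithTop.coe_le_coe.2 (le_top (a := (2 : ℕ∞))))
  refine hx.trans (Eq.trans ?_ ht.symm)
  simpa using hsymm.eq (0, 0, 1) (1, 0, 0)

theorem stmt_4 (ε : ℝ) (u : ℝ → ℝ → ℝ → ℝ) (hu : Smooth3 u)
    (ht : ∀ x y t : ℝ, pdt u x y t =
      3 * u x y t * pdx u x y t + ε ^ 2 * pdx (pdx (pdx u)) x y t)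
    (hy : ∀ x y t : ℝ, pdy u x y t =
      (15 / 2) * (u x y t) ^ 2 * pdx u x y t
        + 5 * ε ^ 2 * (u x y t * pdx (pdx (pdx u)) x y t
            + 2 * pdx u x y t * pdx (pdx u) x y t)
        + ε ^ 4 * pdx (pdx (pdx (pdx (pdx u)))) x y t) :
    Mikhalev u (fun x y t => (3 / 2) * (u x y t) ^ 2 + ε ^ 2 * pdx (pdx u) x y t) := by
  have h1 := hu.pdx
  have h2 := h1.pdx
  have h3 := h2.pdx
  have h4 := h3.pdx
  have hut : pdt u = fun x y t =>
      3 * u x y t * pdx u x y t + ε ^ 2 * pdx (pdx (pdx u)) x y t := by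
    funext x y t
    exact ht x y t
  have hutx : pdx (pdt u) = fun x y t =>
      3 * (pdx u x y t) ^ 2 + 3 * u x y t * pdx (pdx u) x y t
        + ε ^ 2 * pdx (pdx (pdx (pdx u))) x y t := by
    funext x y t
    rw [hut]
    refine (((((hu.hasDerivAt_x x y t).const_mul 3).mul (h1.hasDerivAt_x x y t)).add
      ((h3.hasDerivAt_x x y t).const_mul (ε ^ 2))).congr_deriv ?_).deriv
    ring
  have hutxx : ∀ x y t, pdx (pdx (pdt u)) x y t =
      9 * pdx u x y t * pdx (pdx u) x y t + 3 * u x y t * pdx (pdx (pdx u)) x y t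
        + ε ^ 2 * pdx (pdx (pdx (pdx (pdx u)))) x y t := by
    intro x y t
    rw [hutx]
    refine ((((((h1.hasDerivAt_x x y t).pow 2).const_mul 3).add
      (((hu.hasDerivAt_x x y t).const_mul 3).mul (h2.hasDerivAt_x x y t))).add
      ((h4.hasDerivAt_x x y t).const_mul (ε ^ 2))).congr_deriv ?_).deriv
    simp only [Nat.cast_ofNat]
    ring
  intro x y t
  have hwx : pdx (fun x y t => (3 / 2) * (u x y t) ^ 2 + ε ^ 2 * pdx (pdx u) x y t) x y t =
      3 * u x y t * pdx u x y t + ε ^ 2 * pdx (pdx (pdx u)) x y t := by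
    refine (((((hu.hasDerivAt_x x y t).pow 2).const_mul (3 / 2)).add
      ((h2.hasDerivAt_x x y t).const_mul (ε ^ 2))).congr_deriv ?_).deriv
    simp only [Nat.cast_ofNat]
    ring
  have hwt : pdt (fun x y t => (3 / 2) * (u x y t) ^ 2 + ε ^ 2 * pdx (pdx u) x y t) x y t =
      3 * u x y t * pdt u x y t + ε ^ 2 * pdx (pdx (pdt u)) x y t := by
    rw [← hu.pdt_pdx, ← h1.pdt_pdx]
    refine (((((hu.hasDerivAt_t x y t).pow 2).const_mul (3 / 2)).add
      ((h2.hasDerivAt_t x y t).const_mul (ε ^ 2))).congr_deriv ?_).deriv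
    simp only [Nat.cast_ofNat]
    ring
  refine ⟨by rw [hwx, ht], ?_⟩
  rw [hwx, hwt, hy, hutxx, ht]
  ring
end

section
/- For all natural numbers n and k, the equality p_k(n) = p_{k+2}(n+2) holds if and only if 2k ≥ n, where p_k(n) denotes the number of partitions of n into exactly k parts. -/
/-- `partitionsWithParts n k` is the number of partitions of `n` into exactly `k`
(positive) parts. -/
noncomputable def partitionsWithParts (n k : ℕ) : ℕ :=
  Nat.card {P : n.Partition // Multiset.card P.parts = k}

theorem Multiset.two_mul_card_le_sum_add_count_one (s : Multiset ℕ) (hs : ∀ x ∈ s, 0 < x) :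
    2 * s.card ≤ s.sum + s.count 1 := by
  induction s using Multiset.induction_on with
  | empty => simp
  | cons a s ih =>
    have ha : 0 < a := hs a (Multiset.mem_cons_self a s)
    have ih' := ih fun x hx => hs x (Multiset.mem_cons_of_mem hx)
    rw [Multiset.card_cons, Multiset.sum_cons, Multiset.count_cons]
    split_ifs <;> omega

/-- Adjoin two parts equal to `1` to a partition of `n` into `k` parts. -/
def addTwoOnes (n k : ℕ) (P : {P : n.Partition // Multiset.card P.parts = k}) :
    {Q : (n + 2).Partition // Multiset.card Q.parts = k + 2} :=
  ⟨{ parts := P.1.parts + Multiset.replicate 2 1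
     parts_pos := by
      intro i hi
      rcases Multiset.mem_add.1 hi with h | h
      · exact P.1.parts_pos h
      · rw [Multiset.eq_of_mem_replicate h]
        exact one_pos
     parts_sum := by
      rw [Multiset.sum_add, P.1.parts_sum, Multiset.sum_replicate, smul_eq_mul] },
    by simp [P.2]⟩

theorem addTwoOnes_injective (n k : ℕ) : Function.Injective (addTwoOnes n k) := by
  intro P Q h
  have h' : P.1.parts + Multiset.replicate 2 1 = Q.1.parts + Multiset.replicate 2 1 :=
    congrArg (fun R => R.1.parts) h
  exact Subtype.ext (Nat.Partition.ext (add_right_cancel h'))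

theorem addTwoOnes_surjective_iff (n k : ℕ) :
    Function.Surjective (addTwoOnes n k) ↔ n ≤ 2 * k := by
  constructor
  · intro h
    by_contra! hlt
    let Q : (n + 2).Partition :=
      { parts := (n - 2 * k) ::ₘ Multiset.replicate (k + 1) 2
        parts_pos := by
          intro i hi
          rcases Multiset.mem_cons.1 hi with h | h
          · omega
          · rw [Multiset.eq_of_mem_replicate h]
            exact two_pos
        parts_sum := by
          simp only [Multiset.sum_cons, Multiset.sum_replicate, smul_eq_mul]
          omega }
    obtain ⟨P, hP⟩ := h ⟨Q, by simp [Q]⟩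
    have hparts : P.1.parts + Multiset.replicate 2 1 =
        (n - 2 * k) ::ₘ Multiset.replicate (k + 1) 2 :=
      congrArg (fun R => R.1.parts) hP
    have hcount := congrArg (Multiset.count 1) hparts
    rw [Multiset.count_add, Multiset.count_replicate_self, Multiset.count_cons,
      Multiset.count_replicate, if_neg (by decide)] at hcount
    split_ifs at hcount <;> omega
  · rintro h ⟨Q, hQ⟩
    have hcount : 2 ≤ Q.parts.count 1 := by
      have := Q.parts.two_mul_card_le_sum_add_count_one fun x hx => Q.parts_pos hx
      rw [hQ, Q.parts_sum] at this
      omega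
    obtain ⟨s, hs⟩ := Multiset.le_iff_exists_add.1 (Multiset.le_count_iff_replicate_le.1 hcount)
    have hsum : s.sum = n := by
      have := Q.parts_sum
      rw [hs, Multiset.sum_add, Multiset.sum_replicate, smul_eq_mul] at this
      omega
    have hcard : s.card = k := by
      rw [hs, Multiset.card_add, Multiset.card_replicate] at hQ
      omega
    refine ⟨⟨⟨s, fun hi => Q.parts_pos (hs ▸ Multiset.mem_add.2 (Or.inr hi)), hsum⟩, hcard⟩, ?_⟩
    exact Subtype.ext (Nat.Partition.ext ((add_comm _ _).trans hs.symm))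

theorem stmt_6 (n k : ℕ) :
    partitionsWithParts n k = partitionsWithParts (n + 2) (k + 2) ↔ 2 * k ≥ n := by
  rw [ge_iff_le, ← addTwoOnes_surjective_iff]
  constructor
  · intro h
    exact ((addTwoOnes_injective n k).bijective_of_nat_card_le h.ge).surjective
  · intro h
    exact Nat.card_eq_of_bijective _ ⟨addTwoOnes_injective n k, h⟩
end

section
/- Fix n ≥ 1 and continuously differentiable functions f_1, …, f_n : ℝ → ℝ. For R = (R¹,…,Rⁿ) ∈ ℝⁿ set s = R¹ + ⋯ + Rⁿ, η^i(R) = s + f_i'(R^i), and μ^i(R) = f_i'(R^i)² + f_i'(R^i)·s + s²/2 + Σ_k f_k(R^k). Let R¹,…,Rⁿ : ℝ³ → ℝ be smooth functions of (x,y,t) satisfying, for each i, R^i_t = η^i(R)·R^i_x and R^i_y = μ^i(R)·R^i_x at every point. Then u = Σ_k R^k and w = (Σ_k R^k)²/2 + Σ_k f_k(R^k) form a solution of the Mikhalev system. -/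
theorem hasDerivAt_sum_sq_half_add_sum_comp {n : ℕ} {f : Fin n → ℝ → ℝ}
    (hf : ∀ i, Differentiable ℝ (f i)) {r : Fin n → ℝ → ℝ} {r' : Fin n → ℝ} {a : ℝ}
    (hr : ∀ i, HasDerivAt (r i) (r' i) a) :
    HasDerivAt (fun s => (∑ k, r k s) ^ 2 / 2 + ∑ k, f k (r k s))
      ((∑ k, r k a) * ∑ k, r' k + ∑ k, deriv (f k) (r k a) * r' k) a := by
  have hsum : HasDerivAt (fun s => ∑ k, r k s) (∑ k, r' k) a :=
    HasDerivAt.fun_sum fun k _ => hr k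
  have hcomp : HasDerivAt (fun s => ∑ k, f k (r k s)) (∑ k, deriv (f k) (r k a) * r' k) a :=
    HasDerivAt.fun_sum fun k _ => (hf k (r k a)).hasDerivAt.comp a (hr k)
  refine (((hsum.pow 2).div_const 2).add hcomp).congr_deriv ?_
  push_cast
  ring

namespace Smooth3

variable {u : ℝ → ℝ → ℝ → ℝ}

theorem hasDerivAt_pdy (hu : Smooth3 u) (x y t : ℝ) :
    HasDerivAt (fun s => u x s t) (pdy u x y t) y := by
  have h : Differentiable ℝ (fun p : ℝ × ℝ × ℝ => u p.1 p.2.1 p.2.2) :=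
    ContDiff.differentiable hu (by simp)
  have hc : Differentiable ℝ (fun s : ℝ => (x, s, t)) := by fun_prop
  exact ((h.comp hc) y).hasDerivAt

end Smooth3

theorem stmt_7 (n : ℕ) (hn : 1 ≤ n)
    (f : Fin n → ℝ → ℝ) (hf : ∀ i, ContDiff ℝ 1 (f i))
    (R : Fin n → ℝ → ℝ → ℝ → ℝ) (hR : ∀ i, Smooth3 (R i))
    (ht : ∀ i x y t, pdt (R i) x y t =
      ((∑ k, R k x y t) + deriv (f i) (R i x y t)) * pdx (R i) x y t)
    (hy : ∀ i x y t, pdy (R i) x y t =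
      ((deriv (f i) (R i x y t)) ^ 2
        + deriv (f i) (R i x y t) * (∑ k, R k x y t)
        + (∑ k, R k x y t) ^ 2 / 2
        + ∑ k, f k (R k x y t)) * pdx (R i) x y t) :
    Mikhalev (fun x y t => ∑ k, R k x y t)
      (fun x y t => (∑ k, R k x y t) ^ 2 / 2 + ∑ k, f k (R k x y t)) := by
  intro x y t
  have hf' : ∀ i, Differentiable ℝ (f i) := fun i => (hf i).differentiable (by simp)
  have hx' := fun i => (hR i).hasDerivAt_pdx x y t
  have hy' := fun i => (hR i).hasDerivAt_pdy x y t
  have ht' := fun i => (hR i).hasDerivAt_pdt x y t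
  have ux : pdx (fun x y t => ∑ k, R k x y t) x y t = ∑ k, pdx (R k) x y t :=
    (HasDerivAt.fun_sum fun k _ => hx' k).deriv
  have uy : pdy (fun x y t => ∑ k, R k x y t) x y t = ∑ k, pdy (R k) x y t :=
    (HasDerivAt.fun_sum fun k _ => hy' k).deriv
  have ut : pdt (fun x y t => ∑ k, R k x y t) x y t = ∑ k, pdt (R k) x y t :=
    (HasDerivAt.fun_sum fun k _ => ht' k).deriv
  have wx : pdx (fun x y t => (∑ k, R k x y t) ^ 2 / 2 + ∑ k, f k (R k x y t)) x y t = _ :=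
    (hasDerivAt_sum_sq_half_add_sum_comp hf' hx').deriv
  have wt : pdt (fun x y t => (∑ k, R k x y t) ^ 2 / 2 + ∑ k, f k (R k x y t)) x y t = _ :=
    (hasDerivAt_sum_sq_half_add_sum_comp hf' ht').deriv
  rw [ux, uy, ut, wx, wt]
  simp only [ht, hy]
  generalize (∑ k, R k x y t) = s
  generalize (∑ k, f k (R k x y t)) = φ
  constructor
  · simp only [add_mul, Finset.sum_add_distrib, Finset.mul_sum]
  · simp only [Finset.mul_sum, ← Finset.sum_add_distrib, ← Finset.sum_sub_distrib]
    exact Finset.sum_congr rfl fun k _ => by ring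
end

section
/- Fix n ≥ 2 and twice continuously differentiable functions f_1, …, f_n : ℝ → ℝ. For R = (R¹,…,Rⁿ) ∈ ℝⁿ set s = R¹ + ⋯ + Rⁿ, η^i(R) = s + f_i'(R^i), and μ^i(R) = f_i'(R^i)² + f_i'(R^i)·s + s²/2 + Σ_k f_k(R^k). Then for all indices i ≠ j and every point R ∈ ℝⁿ, the Tsarev commutativity condition holds in the cross-multiplied form: (∂η^i/∂R^j)·(μ^j(R) − μ^i(R)) = (∂μ^i/∂R^j)·(η^j(R) − η^i(R)). -/
/-- Characteristic speed `η^i` of the `t`-flow of the `n`-component hydrodynamic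
reductions of the Mikhalev system. -/
noncomputable def etaSpeed {n : ℕ} (f : Fin n → ℝ → ℝ) (i : Fin n) (R : Fin n → ℝ) : ℝ :=
  (∑ k, R k) + deriv (f i) (R i)

/-- Characteristic speed `μ^i` of the `y`-flow of the `n`-component hydrodynamic
reductions of the Mikhalev system. -/
noncomputable def muSpeed {n : ℕ} (f : Fin n → ℝ → ℝ) (i : Fin n) (R : Fin n → ℝ) : ℝ :=
  (deriv (f i) (R i)) ^ 2 + deriv (f i) (R i) * (∑ k, R k)
    + (∑ k, R k) ^ 2 / 2 + ∑ k, f k (R k)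

/-- Partial derivative of a function on `ℝⁿ` with respect to the `j`-th coordinate. -/
noncomputable def pdj {n : ℕ} (F : (Fin n → ℝ) → ℝ) (j : Fin n) (R : Fin n → ℝ) : ℝ :=
  deriv (fun s => F (Function.update R j s)) (R j)

theorem hasDerivAt_sum_update {n : ℕ} {g : Fin n → ℝ → ℝ} {g' : ℝ} (j : Fin n)
    (R : Fin n → ℝ) (hg : HasDerivAt (g j) g' (R j)) :
    HasDerivAt (fun s => ∑ k, g k (Function.update R j s k)) g' (R j) := by
  have h : (fun s => ∑ k, g k (Function.update R j s k))
      = fun s => g j s + ∑ k ∈ Finset.univ.erase j, g k (R k) := by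
    funext s
    rw [← Finset.add_sum_erase _ _ (Finset.mem_univ j), Function.update_self]
    congr 1
    refine Finset.sum_congr rfl fun k hk => ?_
    rw [Function.update_of_ne (Finset.ne_of_mem_erase hk)]
  rw [h]
  exact hg.add_const _

theorem pdj_etaSpeed {n : ℕ} (f : Fin n → ℝ → ℝ) {i j : Fin n} (hij : i ≠ j)
    (R : Fin n → ℝ) : pdj (etaSpeed f i) j R = 1 := by
  have hs := hasDerivAt_sum_update (g := fun _ x => x) j R (hasDerivAt_id' (R j))
  simp only [pdj, etaSpeed, Function.update_of_ne hij]
  exact (hs.add_const _).deriv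

theorem pdj_muSpeed {n : ℕ} (f : Fin n → ℝ → ℝ) {i j : Fin n} (hij : i ≠ j)
    (R : Fin n → ℝ) (hf : DifferentiableAt ℝ (f j) (R j)) :
    pdj (muSpeed f i) j R = deriv (f i) (R i) + (∑ k, R k) + deriv (f j) (R j) := by
  have hs := hasDerivAt_sum_update (g := fun _ x => x) j R (hasDerivAt_id' (R j))
  have hF := hasDerivAt_sum_update j R hf.hasDerivAt
  have h := (((hs.const_mul (deriv (f i) (R i))).const_add (deriv (f i) (R i) ^ 2)).add
    ((hs.pow 2).div_const 2)).add hF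
  simp only [pdj, muSpeed, Function.update_of_ne hij]
  refine h.deriv.trans ?_
  simp only [Function.update_eq_self]
  norm_num

theorem stmt_8 (n : ℕ) (hn : 2 ≤ n)
    (f : Fin n → ℝ → ℝ) (hf : ∀ i, ContDiff ℝ 2 (f i)) :
    ∀ (i j : Fin n), i ≠ j → ∀ R : Fin n → ℝ,
      pdj (etaSpeed f i) j R * (muSpeed f j R - muSpeed f i R)
        = pdj (muSpeed f i) j R * (etaSpeed f j R - etaSpeed f i R) := by
  intro i j hij R
  rw [pdj_etaSpeed f hij,
    pdj_muSpeed f hij R ((hf j).differentiable (by norm_num)).differentiableAt]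
  simp only [muSpeed, etaSpeed]
  ring
end

section
/- Let η, ψ, φ : ℝ² → ℝ be smooth functions of the variables (u, w). Then the linear degeneracy conditions η_w = 0, ψ_w + η_u = 0, φ_w + ψ_u = 0, φ_u = 0 hold at every point if and only if there exist constants c, α, β, γ, δ, μ ∈ ℝ such that η(u,w) = c·u² + α·u + β, φ(u,w) = c·w² + γ·w + δ, and ψ(u,w) = −2c·u·w − α·w − γ·u − μ. -/
/-- Partial derivative with respect to the first variable `u`. -/
noncomputable def pdu (F : ℝ → ℝ → ℝ) (u w : ℝ) : ℝ := deriv (fun s => F s w) u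

/-- Partial derivative with respect to the second variable `w`. -/
noncomputable def pdw (F : ℝ → ℝ → ℝ) (u w : ℝ) : ℝ := deriv (fun s => F u s) w

/-- Smoothness of a function of two real variables. -/
def Smooth2 (F : ℝ → ℝ → ℝ) : Prop :=
  ContDiff ℝ (⊤ : ℕ∞) (fun p : ℝ × ℝ => F p.1 p.2)

theorem Smooth2.differentiable_left {F : ℝ → ℝ → ℝ} (hF : Smooth2 F) (w : ℝ) :
    Differentiable ℝ (fun s => F s w) := by
  have h : Differentiable ℝ (fun p : ℝ × ℝ => F p.1 p.2) := ContDiff.differentiable hF (by simp)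
  exact h.comp (f := fun s : ℝ => (s, w)) (by fun_prop)

theorem Smooth2.differentiable_right {F : ℝ → ℝ → ℝ} (hF : Smooth2 F) (u : ℝ) :
    Differentiable ℝ (fun s => F u s) := by
  have h : Differentiable ℝ (fun p : ℝ × ℝ => F p.1 p.2) := ContDiff.differentiable hF (by simp)
  exact h.comp (f := fun s : ℝ => (u, s)) (by fun_prop)

theorem hasDerivAt_quadratic (a b c x : ℝ) :
    HasDerivAt (fun t : ℝ => a * t ^ 2 + b * t + c) (2 * a * x + b) x := by
  have h := ((((hasDerivAt_id x).pow 2).const_mul a).add ((hasDerivAt_id x).const_mul b)).add_const c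
  exact h.congr_deriv (by simp; ring)

/-- A differentiable function with affine derivative is a quadratic polynomial. -/
theorem eq_quadratic_of_deriv {f : ℝ → ℝ} (hf : Differentiable ℝ f) {a b : ℝ}
    (h : ∀ x, deriv f x = 2 * a * x + b) (x : ℝ) : f x = a * x ^ 2 + b * x + f 0 := by
  have hd : ∀ y, HasDerivAt (fun t => f t - (a * t ^ 2 + b * t + 0)) 0 y := fun y => by
    have h1 := (hf y).hasDerivAt.sub (hasDerivAt_quadratic a b 0 y)
    rw [h y, sub_self] at h1
    exact h1
  have h0 := is_const_of_deriv_eq_zero (fun y => (hd y).differentiableAt)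
    (fun y => (hd y).deriv) x 0
  linarith

theorem stmt_18 (η ψ φ : ℝ → ℝ → ℝ)
    (hη : Smooth2 η) (hψ : Smooth2 ψ) (hφ : Smooth2 φ) :
    (∀ u w : ℝ,
        pdw η u w = 0 ∧ pdw ψ u w + pdu η u w = 0 ∧
        pdw φ u w + pdu ψ u w = 0 ∧ pdu φ u w = 0)
      ↔ ∃ c α β γ δ μ : ℝ, ∀ u w : ℝ,
          η u w = c * u ^ 2 + α * u + β ∧
          φ u w = c * w ^ 2 + γ * w + δ ∧
          ψ u w = -2 * c * u * w - α * w - γ * u - μ := by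
  constructor
  · intro h
    have hη0 : ∀ u w, η u w = η u 0 := fun u w =>
      is_const_of_deriv_eq_zero (hη.differentiable_right u) (fun y => (h u y).1) w 0
    have hφ0 : ∀ u w, φ u w = φ 0 w := fun u w =>
      is_const_of_deriv_eq_zero (hφ.differentiable_left w) (fun y => (h y w).2.2.2) u 0
    have hηd : ∀ u w, pdu η u w = pdu η u 0 := fun u w => by
      simp only [pdu, fun s => hη0 s w]
    have hφd : ∀ u w, pdw φ u w = pdw φ 0 w := fun u w => by
      simp only [pdw, fun s => hφ0 u s]
    have hψw : ∀ u w, ψ u w = -pdu η u 0 * w + ψ u 0 := fun u w => by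
      have := eq_quadratic_of_deriv (hψ.differentiable_right u) (a := 0) (b := -pdu η u 0)
        (fun y => by
          have h1 := (h u y).2.1
          rw [hηd u y] at h1
          change pdw ψ u y = _
          linarith) w
      linarith
    have hψu : ∀ u w, ψ u w = -pdw φ 0 w * u + ψ 0 w := fun u w => by
      have := eq_quadratic_of_deriv (hψ.differentiable_left w) (a := 0) (b := -pdw φ 0 w)
        (fun y => by
          have h1 := (h y w).2.2.1
          rw [hφd y w] at h1
          change pdu ψ y w = _
          linarith) u
      linarith
    have hcross : ∀ u w, (pdu η u 0 - pdu η 0 0) * w = (pdw φ 0 w - pdw φ 0 0) * u :=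
      fun u w => by
        linarith [hψw u w, hψu u w, hψw 0 w, hψu u 0]
    set k := pdw φ 0 1 - pdw φ 0 0 with hk
    have hA : ∀ u, pdu η u 0 = 2 * (k / 2) * u + pdu η 0 0 := fun u => by
      linarith [hcross u 1]
    have hB : ∀ w, pdw φ 0 w = 2 * (k / 2) * w + pdw φ 0 0 := fun w => by
      have h1 := hcross 1 w
      rw [hA 1] at h1
      linarith
    refine ⟨k / 2, pdu η 0 0, η 0 0, pdw φ 0 0, φ 0 0, -ψ 0 0, fun u w => ⟨?_, ?_, ?_⟩⟩
    · rw [hη0]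
      exact eq_quadratic_of_deriv (hη.differentiable_left 0) hA u
    · rw [hφ0]
      exact eq_quadratic_of_deriv (hφ.differentiable_right 0) hB w
    · rw [hψw u w, hψu u 0, hA u]
      ring
  · rintro ⟨c, α, β, γ, δ, μ, h⟩ u w
    have hη' : ∀ u w, η u w = c * u ^ 2 + α * u + β := fun u w => (h u w).1
    have hφ' : ∀ u w, φ u w = c * w ^ 2 + γ * w + δ := fun u w => (h u w).2.1
    have hψw : pdw ψ u w = -2 * c * u - α := by
      have h1 : (fun s => ψ u s) =
          fun s => 0 * s ^ 2 + (-2 * c * u - α) * s + (-γ * u - μ) := by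
        funext s
        rw [(h u s).2.2]
        ring
      rw [pdw, h1, (hasDerivAt_quadratic _ _ _ w).deriv]
      ring
    have hψu : pdu ψ u w = -2 * c * w - γ := by
      have h1 : (fun s => ψ s w) =
          fun s => 0 * s ^ 2 + (-2 * c * w - γ) * s + (-α * w - μ) := by
        funext s
        rw [(h s w).2.2]
        ring
      rw [pdu, h1, (hasDerivAt_quadratic _ _ _ u).deriv]
      ring
    have hηu : pdu η u w = 2 * c * u + α := by
      simp only [pdu, hη']
      exact (hasDerivAt_quadratic c α β u).deriv
    have hφw : pdw φ u w = 2 * c * w + γ := by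
      simp only [pdw, hφ']
      exact (hasDerivAt_quadratic c γ δ w).deriv
    refine ⟨?_, ?_, ?_, ?_⟩
    · simp [pdw, hη']
    · rw [hψw, hηu]
      ring
    · rw [hφw, hψu]
      ring
    · simp [pdu, hφ']
end

section
/- Let η, ψ, φ : ℝ² → ℝ be smooth functions of the variables (u, w) with η nowhere vanishing, satisfying the linear degeneracy conditions η_w = 0, ψ_w + η_u = 0, φ_w + ψ_u = 0, φ_u = 0, together with the integrability condition η·η_uu = η_w·(ψ_u − φ_w) at every point. Then there exist constants α, β, γ, δ, μ ∈ ℝ such that η(u,w) = α·u + β, φ(u,w) = γ·w + δ, and ψ(u,w) = −α·w − γ·u − μ; in particular, the quadratic coefficient c in the general linearly degenerate solution must vanish. -/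
theorem Smooth2.contDiff_left {F : ℝ → ℝ → ℝ} (hF : Smooth2 F) (w : ℝ) :
    ContDiff ℝ (⊤ : ℕ∞) (fun s => F s w) :=
  ContDiff.comp (g := fun p : ℝ × ℝ => F p.1 p.2) hF (contDiff_id.prodMk contDiff_const)

theorem Smooth2.contDiff_right {F : ℝ → ℝ → ℝ} (hF : Smooth2 F) (u : ℝ) :
    ContDiff ℝ (⊤ : ℕ∞) (fun s => F u s) :=
  ContDiff.comp (g := fun p : ℝ × ℝ => F p.1 p.2) hF (contDiff_const.prodMk contDiff_id)

theorem eq_mul_add_of_deriv_eq_const {f : ℝ → ℝ} {c : ℝ} (hf : Differentiable ℝ f)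
    (hc : ∀ x, deriv f x = c) (x : ℝ) : f x = c * x + f 0 := by
  have hd : ∀ y, HasDerivAt (fun t => f t - c * t) 0 y := fun y => by
    have h := (hf y).hasDerivAt.fun_sub ((hasDerivAt_id y).const_mul c)
    rwa [hc y, mul_one, sub_self] at h
  have h := is_const_of_deriv_eq_zero (fun y => (hd y).differentiableAt) (fun y => (hd y).deriv) x 0
  simp only [mul_zero, sub_zero] at h
  linarith

theorem Smooth2.eq_of_pdu_eq {F : ℝ → ℝ → ℝ} (hF : Smooth2 F) {c w : ℝ}
    (hc : ∀ u, pdu F u w = c) (u : ℝ) : F u w = c * u + F 0 w :=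
  eq_mul_add_of_deriv_eq_const ((hF.contDiff_left w).differentiable (by simp)) hc u

theorem Smooth2.eq_of_pdw_eq {F : ℝ → ℝ → ℝ} (hF : Smooth2 F) {c u : ℝ}
    (hc : ∀ w, pdw F u w = c) (w : ℝ) : F u w = c * w + F u 0 :=
  eq_mul_add_of_deriv_eq_const ((hF.contDiff_right u).differentiable (by simp)) hc w

theorem Smooth2.differentiable_pdu {F : ℝ → ℝ → ℝ} (hF : Smooth2 F) (w : ℝ) :
    Differentiable ℝ (fun s => pdu F s w) :=
  (contDiff_infty.mp (hF.contDiff_left w) 2).differentiable_deriv_two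

theorem stmt_19 (η ψ φ : ℝ → ℝ → ℝ)
    (hη : Smooth2 η) (hψ : Smooth2 ψ) (hφ : Smooth2 φ)
    (hη0 : ∀ u w : ℝ, η u w ≠ 0)
    (hld : ∀ u w : ℝ,
      pdw η u w = 0 ∧ pdw ψ u w + pdu η u w = 0 ∧
      pdw φ u w + pdu ψ u w = 0 ∧ pdu φ u w = 0)
    (hint : ∀ u w : ℝ,
      η u w * pdu (pdu η) u w = pdw η u w * (pdu ψ u w - pdw φ u w)) :
    ∃ α β γ δ μ : ℝ, ∀ u w : ℝ,
      η u w = α * u + β ∧ φ u w = γ * w + δ ∧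
      ψ u w = -α * w - γ * u - μ := by
  have hη_w (u w : ℝ) : η u w = η u 0 := by
    simpa using hη.eq_of_pdw_eq (fun w => (hld u w).1) w
  have hη_uu (u w : ℝ) : pdu (pdu η) u w = 0 := by
    have h := hint u w
    rw [(hld u w).1, zero_mul] at h
    exact (mul_eq_zero.mp h).resolve_left (hη0 u w)
  have hη_u (u w : ℝ) : pdu η u w = pdu η 0 0 := by
    have h : pdu η u w = pdu η 0 w :=
      is_const_of_deriv_eq_zero (hη.differentiable_pdu w) (fun s => hη_uu s w) u 0
    rw [h]
    simp only [pdu, hη_w _ w]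
  have hφ_u (u w : ℝ) : φ u w = φ 0 w := by
    simpa using hφ.eq_of_pdu_eq (fun u => (hld u w).2.2.2) u
  have hψ_w (u w : ℝ) : ψ u w = -pdu η 0 0 * w + ψ u 0 :=
    hψ.eq_of_pdw_eq (fun w => by linarith [(hld u w).2.1, hη_u u w]) w
  have hφ_w (u w : ℝ) : pdw φ u w = pdw φ 0 w := by
    simp only [pdw, hφ_u u]
  have hψ_u (u w : ℝ) : pdu ψ u w = pdu ψ u 0 := by
    simp only [pdu, hψ_w _ w, deriv_const_add]
  have hφ_w_const (w : ℝ) : pdw φ 0 w = pdw φ 0 0 := by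
    linarith [(hld 0 w).2.2.1, (hld 0 0).2.2.1, hψ_u 0 w]
  refine ⟨pdu η 0 0, η 0 0, pdw φ 0 0, φ 0 0, -ψ 0 0, fun u w => ⟨?_, ?_, ?_⟩⟩
  · rw [hη_w, hη.eq_of_pdu_eq (fun u => hη_u u 0)]
  · rw [hφ_u, hφ.eq_of_pdw_eq hφ_w_const]
  · rw [hψ_w, hψ.eq_of_pdu_eq (c := -pdw φ 0 0)
      (fun u => by linarith [(hld u 0).2.2.1, hφ_w u 0])]
    ring
end
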